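/- Let a, b > 0 with θ = a/b irrational. If 0 < |α| < π²·min{υ(θ⁻¹)/b, υ(θ)/a}, then only finitely many positive integers m satisfy (2mπ/a)·tan((π/2)·(⌈mθ⁻¹⌉ − mθ⁻¹)) < |α| or (2mπ/b)·tan((π/2)·(⌈mθ⌉ − mθ)) < |α|. If instead |α| > π²·min{υ(θ⁻¹)/b, υ(θ)/a}, then infinitely many positive integers m satisfy at least one of these two inequalities. -/

import Mathlib

open Real

/-- The one-sided Markov constant
`υ(θ) := inf {c > 0 : ∃∞ (p,q) ∈ ℤ², q ≠ 0, 0 < θ - p/q < c/q²}`. -/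
noncomputable def upsilon (θ : ℝ) : ℝ :=
  sInf {c : ℝ | 0 < c ∧
    {pq : ℤ × ℤ | pq.2 ≠ 0 ∧ 0 < θ - (pq.1 : ℝ) / (pq.2 : ℝ) ∧
      θ - (pq.1 : ℝ) / (pq.2 : ℝ) < c / (pq.2 : ℝ) ^ 2}.Infinite}

open Filter Topology

lemma mul_sub_pos_of_irrational_of_nonneg {θ : ℝ} (h : Irrational θ) {p q : ℤ} (hq : 0 < q)
    (h0 : 0 ≤ q * θ - p) : 0 < q * θ - p := by
  refine lt_of_le_of_ne h0 fun he => ?_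
  exact ((h.intCast_mul hq.ne').sub_intCast p).ne_zero he.symm

/-- If `0 < y < x`, subtracting a positive multiple of `y` from `x` leaves a remainder in `[0, y)`. -/
lemma exists_int_mul_le_lt {x y : ℝ} (hy : 0 < y) (hxy : y < x) :
    ∃ k : ℤ, 1 ≤ k ∧ 0 ≤ x - k * y ∧ x - k * y < y := by
  refine ⟨⌊x / y⌋, Int.le_floor.2 ?_, ?_, ?_⟩
  · rw [le_div_iff₀ hy]; push_cast; linarith
  · have := Int.floor_le (x / y)
    rw [le_div_iff₀ hy] at this; linarith
  · have := Int.lt_floor_add_one (x / y)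
    rw [div_lt_iff₀ hy] at this; linarith

lemma exists_unimodular_bracket {θ : ℝ} (h : Irrational θ) (n : ℕ) :
    ∃ p q p' q' : ℤ, (n : ℤ) < q ∧ 0 ≤ q' ∧ p' * q - p * q' = 1 ∧
      0 < q * θ - p ∧ q * θ - p < p' - q' * θ := by
  induction n with
  | zero =>
    refine ⟨⌊θ⌋, 1, 1, 0, by simp, le_rfl, by simp, ?_, ?_⟩
    · refine mul_sub_pos_of_irrational_of_nonneg h one_pos ?_
      have := Int.floor_le θ
      push_cast; linarith
    · have := Int.lt_floor_add_one θ
      push_cast; linarith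
  | succ n ih =>
    obtain ⟨p, q, p', q', hq, hq', hdet, hpos, hlt⟩ := ih
    have hq0 : 0 < q := by omega
    obtain ⟨k, hk, hk0, hk1⟩ := exists_int_mul_le_lt hpos hlt
    have hkq : q ≤ k * q := by nlinarith
    have hpos' : 0 < (p' - q' * θ) - k * (q * θ - p) := by
      have := mul_sub_pos_of_irrational_of_nonneg h.neg (p := -(p' + k * p)) (q := q' + k * q)
        (by omega) (by push_cast; linarith)
      push_cast at this; linarith
    obtain ⟨l, hl, hl0, hl1⟩ := exists_int_mul_le_lt hpos' hk1
    have hlq : q' + k * q ≤ l * (q' + k * q) := by nlinarith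
    refine ⟨p + l * (p' + k * p), q + l * (q' + k * q), p' + k * p, q' + k * q,
      by push_cast; omega, by omega, by linear_combination hdet, ?_, ?_⟩
    · refine mul_sub_pos_of_irrational_of_nonneg h (by omega) ?_
      push_cast; linarith
    · push_cast; linarith

lemma infinite_one_sided_approximations {θ : ℝ} (h : Irrational θ) :
    {pq : ℤ × ℤ | pq.2 ≠ 0 ∧ 0 < θ - (pq.1 : ℝ) / (pq.2 : ℝ) ∧
      θ - (pq.1 : ℝ) / (pq.2 : ℝ) < 2 / (pq.2 : ℝ) ^ 2}.Infinite := by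
  refine Set.Infinite.of_image Prod.snd (Set.infinite_of_not_bddAbove ?_)
  rintro ⟨B, hB⟩
  obtain ⟨p, q, p', q', hq, hq', hdet, hpos, hlt⟩ := exists_unimodular_bracket h B.toNat
  have hq0 : 0 < q := by omega
  have hqr : (0 : ℝ) < q := by exact_mod_cast hq0
  have hqr' : (0 : ℝ) ≤ q' := by exact_mod_cast hq'
  have hdet' : (p' * q - p * q' : ℝ) = 1 := by exact_mod_cast hdet
  have he : θ - (p : ℝ) / q = (q * (q * θ - p)) / (q : ℝ) ^ 2 := by field_simp
  have : q ≤ B := hB ⟨(p, q), ⟨hq0.ne', ?_, ?_⟩, rfl⟩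
  · omega
  · simp only [he]; positivity
  · simp only [he]
    gcongr
    nlinarith [mul_lt_mul_of_pos_left hlt hqr, mul_nonneg hqr' hpos.le]

lemma frequently_approximation_of_infinite {θ c : ℝ} (hc : 0 < c)
    (h : {pq : ℤ × ℤ | pq.2 ≠ 0 ∧ 0 < θ - (pq.1 : ℝ) / (pq.2 : ℝ) ∧
      θ - (pq.1 : ℝ) / (pq.2 : ℝ) < c / (pq.2 : ℝ) ^ 2}.Infinite) :
    ∃ᶠ q : ℕ in atTop, ∃ p : ℤ, 0 < θ - (p : ℝ) / q ∧ θ - (p : ℝ) / q < c / (q : ℝ) ^ 2 := by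
  intro hev
  obtain ⟨N, hN⟩ := eventually_atTop.1 hev
  set B : ℤ := ⌈(N : ℝ) * (|θ| + c)⌉
  refine h (((Set.finite_Icc (-B) B).prod (Set.finite_Icc (-(N : ℤ)) N)).subset ?_)
  rintro ⟨p, q⟩ ⟨hq, h1, h2⟩
  simp only at hq h1 h2
  have hqN : |q| < N := by
    by_contra! hge
    apply hN q.natAbs (by rw [Int.abs_eq_natAbs] at hge; omega)
    have hcast : ((q.natAbs : ℕ) : ℝ) = |(q : ℝ)| := by simp [Nat.cast_natAbs]
    rw [hcast, sq_abs]
    rcases hq.lt_or_gt with hneg | hpos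
    · refine ⟨-p, ?_⟩
      rw [abs_of_neg (by exact_mod_cast hneg)]
      push_cast
      rw [neg_div_neg_eq]
      exact ⟨h1, h2⟩
    · refine ⟨p, ?_⟩
      rw [abs_of_pos (by exact_mod_cast hpos)]
      exact ⟨h1, h2⟩
  have hq1 : (1 : ℝ) ≤ |(q : ℝ)| := by exact_mod_cast Int.one_le_abs hq
  have hc' : c / (q : ℝ) ^ 2 ≤ c := div_le_self hc.le (by rw [← sq_abs]; nlinarith)
  have hpq : |(p : ℝ) / q| ≤ |θ| + c :=
    abs_le.2 ⟨by linarith [neg_abs_le θ], by linarith [le_abs_self θ]⟩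
  have hqN' : |(q : ℝ)| ≤ N := by exact_mod_cast hqN.le
  have hqne : (q : ℝ) ≠ 0 := by exact_mod_cast hq
  have hp : |(p : ℝ)| ≤ B := by
    calc |(p : ℝ)| = |(q : ℝ)| * |(p : ℝ) / q| := by rw [← abs_mul]; field_simp
      _ ≤ N * (|θ| + c) := by gcongr
      _ ≤ B := Int.le_ceil _
  have hp' : |p| ≤ B := by exact_mod_cast hp
  exact ⟨abs_le.1 hp', abs_le.1 hqN.le⟩

lemma finite_tan_ceil_lt {x A β : ℝ} (hx : 0 < x) (hA : 0 < A) (hβ : 0 < β)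
    (h : β < π ^ 2 * (upsilon x⁻¹ / A)) (hirr : Irrational x) :
    {m : ℕ | 0 < m ∧ (2 * m * π / A) *
      Real.tan (π / 2 * ((⌈(m : ℝ) * x⌉ : ℝ) - (m : ℝ) * x)) < β}.Finite := by
  by_contra hinf
  have hπ := Real.pi_pos
  obtain ⟨c₀, hc₀⟩ : ∃ c₀, c₀ = β * A / π ^ 2 := ⟨_, rfl⟩
  have hc₀pos : 0 < c₀ := by rw [hc₀]; positivity
  have hlt : c₀ < upsilon x⁻¹ := by
    rw [hc₀, div_lt_iff₀ (by positivity)]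
    rw [← mul_div_assoc, lt_div_iff₀ hA] at h
    linarith
  obtain ⟨c, hc1, hc2⟩ := exists_between hlt
  refine hc2.not_ge (csInf_le ⟨0, fun _ hy => hy.1.le⟩ ⟨hc₀pos.trans hc1, ?_⟩)
  obtain ⟨M, hM⟩ := exists_nat_gt (c₀ / (c - c₀) / x)
  have hinf' := Set.Infinite.sdiff hinf (Set.finite_Iic M)
  have hinj : Function.Injective fun m : ℕ => ((m : ℤ), ⌈(m : ℝ) * x⌉) := fun m n hmn => by
    simpa using congrArg Prod.fst hmn
  refine (hinf'.image hinj.injOn).mono ?_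
  rintro _ ⟨m, ⟨⟨hm, htan⟩, hmM⟩, rfl⟩
  simp only [Set.mem_Iic, not_le] at hmM
  have hm' : (0 : ℝ) < m := by exact_mod_cast hm
  have hmx : 0 < (m : ℝ) * x := by positivity
  have hp : (0 : ℝ) < ⌈(m : ℝ) * x⌉ := hmx.trans_le (Int.le_ceil _)
  have hδ0 : 0 < (⌈(m : ℝ) * x⌉ : ℝ) - m * x := by
    refine sub_pos.2 (lt_of_le_of_ne (Int.le_ceil _) ?_)
    exact (hirr.natCast_mul hm.ne').ne_int _
  have hδ1 : (⌈(m : ℝ) * x⌉ : ℝ) - m * x < 1 := by linarith [Int.ceil_lt_add_one ((m : ℝ) * x)]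
  have hmδ : m * ((⌈(m : ℝ) * x⌉ : ℝ) - m * x) < c₀ := by
    have hle := Real.le_tan (x := π / 2 * ((⌈(m : ℝ) * x⌉ : ℝ) - m * x)) (by positivity)
      (by nlinarith)
    have hlt' := (mul_le_mul_of_nonneg_left hle
      (by positivity : (0 : ℝ) ≤ 2 * m * π / A)).trans_lt htan
    rw [div_mul_eq_mul_div, div_lt_iff₀ hA] at hlt'
    rw [hc₀, lt_div_iff₀ (by positivity)]
    linarith
  have hmlarge : c₀ < (c - c₀) * (m * x) := by
    have hm'' : c₀ / (c - c₀) / x < m := hM.trans (by exact_mod_cast hmM)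
    rw [div_lt_iff₀ hx, div_lt_iff₀ (sub_pos.2 hc1)] at hm''
    linarith
  simp only [Set.mem_ofPred_eq, Int.cast_natCast]
  generalize (⌈(m : ℝ) * x⌉ : ℤ) = p at *
  have he : x⁻¹ - m / p = (p - m * x) / (x * p) := by field_simp
  refine ⟨by exact_mod_cast hp.ne', by rw [he]; positivity, ?_⟩
  calc x⁻¹ - m / p = m * (p - m * x) / (m * x * p) := by rw [he]; field_simp
    _ < c₀ / (m * x * p) := by gcongr
    _ < c / (p : ℝ) ^ 2 := by
      rw [div_lt_div_iff₀ (by positivity) (by positivity)]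
      have : c₀ * p < c * (m * x) := by nlinarith
      nlinarith

lemma infinite_tan_ceil_lt {x A β : ℝ} (hx : 0 < x) (hA : 0 < A)
    (h : π ^ 2 * (upsilon x⁻¹ / A) < β) (hirr : Irrational x) :
    {m : ℕ | 0 < m ∧ (2 * m * π / A) *
      Real.tan (π / 2 * ((⌈(m : ℝ) * x⌉ : ℝ) - (m : ℝ) * x)) < β}.Infinite := by
  have hπ := Real.pi_pos
  obtain ⟨c₀, hc₀⟩ : ∃ c₀, c₀ = β * A / π ^ 2 := ⟨_, rfl⟩
  have hlt : upsilon x⁻¹ < c₀ := by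
    rw [hc₀, lt_div_iff₀ (by positivity)]
    rw [← mul_div_assoc, div_lt_iff₀ hA] at h
    linarith
  obtain ⟨c, ⟨hc, hcinf⟩, hcc₀⟩ := exists_lt_of_csInf_lt
    (by exact ⟨2, two_pos, infinite_one_sided_approximations hirr.inv⟩) hlt
  have hcos : ∀ᶠ t : ℝ in 𝓝 0, c / c₀ < Real.cos t := by
    refine Real.continuous_cos.continuousAt.eventually (lt_mem_nhds ?_)
    rw [Real.cos_zero, div_lt_one (hc.trans hcc₀)]
    exact hcc₀
  obtain ⟨ε, hε, hεcos⟩ := Metric.eventually_nhds_iff.1 hcos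
  refine Set.infinite_of_not_bddAbove ?_
  rintro ⟨M, hM⟩
  have hinv : Tendsto (fun q : ℕ => x * c / (q : ℝ)) atTop (𝓝 0) :=
    tendsto_const_div_atTop_nhds_zero_nat _
  have hlin : Tendsto (fun q : ℕ => x⁻¹ * (q : ℝ)) atTop atTop :=
    tendsto_natCast_atTop_atTop.const_mul_atTop (inv_pos.2 hx)
  obtain ⟨q, ⟨p, h1, h2⟩, hq0, hq1, hqε, hqM⟩ :=
    ((frequently_approximation_of_infinite hc hcinf).and_eventually
      ((eventually_gt_atTop 0).and ((hinv.eventually (gt_mem_nhds one_pos)).and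
        ((hinv.eventually (gt_mem_nhds (div_pos hε hπ))).and
          (hlin.eventually_gt_atTop (M + 1 + x⁻¹)))))).exists
  have hqr : (0 : ℝ) < q := by exact_mod_cast hq0
  obtain ⟨δ, hδ⟩ : ∃ δ, δ = (q : ℝ) - p * x := ⟨_, rfl⟩
  have hδe : δ = x * q * (x⁻¹ - p / q) := by rw [hδ]; field_simp
  have hδ0 : 0 < δ := by rw [hδe]; positivity
  have hδ1 : δ < x * c / q := by
    calc δ = x * q * (x⁻¹ - p / q) := hδe
      _ < x * q * (c / (q : ℝ) ^ 2) := by gcongr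
      _ = x * c / q := by field_simp
  have hpe : (p : ℝ) = x⁻¹ * q - x⁻¹ * δ := by rw [hδ]; field_simp; ring
  have hpM : (M : ℝ) + 1 < p := by
    have : x⁻¹ * δ < x⁻¹ * 1 := by gcongr; linarith
    linarith
  have hpM' : (M : ℤ) + 1 < p := by exact_mod_cast hpM
  lift p to ℕ using by omega
  simp only [Int.cast_natCast] at *
  have hp0 : (0 : ℝ) < p := by linarith [(Nat.cast_nonneg M : (0 : ℝ) ≤ M)]
  have hceil : ⌈(p : ℝ) * x⌉ = (q : ℤ) := by
    rw [Int.ceil_eq_iff]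
    push_cast
    constructor <;> linarith
  have : p ≤ M := hM ⟨by omega, ?_⟩
  · omega
  rw [hceil, Int.cast_natCast, ← hδ]
  have hsmall : |π / 2 * δ| < ε := by
    rw [abs_of_pos (by positivity)]
    have := hδ1.trans hqε
    rw [lt_div_iff₀ hπ] at this
    nlinarith
  have hcosδ : c / c₀ < Real.cos (π / 2 * δ) := hεcos (by rwa [Real.dist_0_eq_abs])
  have hc₀0 : 0 < c₀ := hc.trans hcc₀
  have hmδ : p * δ < c := by
    have hpx : p * x < q := by linarith
    calc p * δ < p * (x * c / q) := by gcongr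
      _ = (p * x) * c / q := by ring
      _ < q * c / q := by gcongr
      _ = c := by field_simp
  have hcospos : 0 < Real.cos (π / 2 * δ) := lt_trans (by positivity) hcosδ
  have htan : Real.tan (π / 2 * δ) ≤ π / 2 * δ / (c / c₀) := by
    rw [Real.tan_eq_sin_div_cos]
    have hsin : Real.sin (π / 2 * δ) ≤ π / 2 * δ := Real.sin_le (by positivity)
    gcongr
  calc 2 * p * π / A * Real.tan (π / 2 * δ)
      ≤ 2 * p * π / A * (π / 2 * δ / (c / c₀)) := by gcongr
    _ = π ^ 2 * c₀ / (A * c) * (p * δ) := by field_simp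
    _ < π ^ 2 * c₀ / (A * c) * c := by gcongr
    _ = β := by rw [hc₀]; field_simp

theorem gaps_attractive_dichotomy (a b α : ℝ) (ha : 0 < a) (hb : 0 < b)
    (hirr : Irrational (a / b)) :
    (0 < |α| → |α| < π ^ 2 * min (upsilon (a / b)⁻¹ / b) (upsilon (a / b) / a) →
      {m : ℕ | 0 < m ∧
          ((2 * m * π / a) * Real.tan (π / 2 *
              ((⌈(m : ℝ) * (a / b)⁻¹⌉ : ℝ) - (m : ℝ) * (a / b)⁻¹)) < |α| ∨
            (2 * m * π / b) * Real.tan (π / 2 *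
              ((⌈(m : ℝ) * (a / b)⌉ : ℝ) - (m : ℝ) * (a / b))) < |α|)}.Finite) ∧
    (π ^ 2 * min (upsilon (a / b)⁻¹ / b) (upsilon (a / b) / a) < |α| →
      {m : ℕ | 0 < m ∧
          ((2 * m * π / a) * Real.tan (π / 2 *
              ((⌈(m : ℝ) * (a / b)⁻¹⌉ : ℝ) - (m : ℝ) * (a / b)⁻¹)) < |α| ∨
            (2 * m * π / b) * Real.tan (π / 2 *
              ((⌈(m : ℝ) * (a / b)⌉ : ℝ) - (m : ℝ) * (a / b))) < |α|)}.Infinite) := by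

  simp only [and_or_left, Set.ofPred_or]
  have hpos : 0 < a / b := div_pos ha hb
  have hπ : 0 < π ^ 2 := by positivity
  constructor
  · intro hα h
    have h1 := h.trans_le (mul_le_mul_of_nonneg_left (min_le_left _ _) hπ.le)
    have h2 := h.trans_le (mul_le_mul_of_nonneg_left (min_le_right _ _) hπ.le)
    refine (finite_tan_ceil_lt (inv_pos.2 hpos) ha hα ?_ hirr.inv).union
      (finite_tan_ceil_lt hpos hb hα h1 hirr)
    rwa [inv_inv]
  · intro h
    rw [mul_min_of_nonneg _ _ hπ.le, min_lt_iff] at h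
    rcases h with h | h
    · exact (infinite_tan_ceil_lt hpos hb h hirr).mono Set.subset_union_right
    · refine (infinite_tan_ceil_lt (inv_pos.2 hpos) ha ?_ hirr.inv).mono Set.subset_union_left
      rwa [inv_inv]
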